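/- arXiv:math/0612252 — 4 statements merged into one kernel-verified Lean document; each statement's English description precedes it below -/
import Mathlib

section
/- Let U ⊆ ℝ⁴ be open and let x ↦ G(x) and x ↦ F(x) be C^∞ maps from U into real 4×4 matrices such that G(x) is symmetric positive definite and F(x) is skew-symmetric for every x ∈ U. For x ∈ U let f1(x) ≥ f2(x) ≥ 0 be the unique real numbers such that the characteristic polynomial of G(x)·F(x) equals (λ² + f1(x)²)(λ² + f2(x)²). If there is ε0 > 0 with f1(x) ≥ ε0 and f2(x) ≥ ε0 for all x ∈ U, then the functions f1 + f2 and (f1 − f2)² are C^∞ on U. -/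
open Polynomial

/-- The determinant of a matrix whose entries are `C^n` on a set is `C^n` on that set. -/
theorem ContDiffOn.matrix_det {𝕜 E ι : Type*} [NontriviallyNormedField 𝕜]
    [NormedAddCommGroup E] [NormedSpace 𝕜 E] [Fintype ι] [DecidableEq ι]
    {n : WithTop ℕ∞} {s : Set E} {A : E → Matrix ι ι 𝕜}
    (hA : ∀ i j, ContDiffOn 𝕜 n (fun x => A x i j) s) :
    ContDiffOn 𝕜 n (fun x => (A x).det) s := by
  simp only [Matrix.det_apply']
  exact ContDiffOn.sum fun σ _ => contDiffOn_const.mul (contDiffOn_prod fun i _ => hA _ _)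

/-- If `x ↦ G x` (symmetric positive definite) and `x ↦ F x`
(skew-symmetric) are smooth matrix-valued maps on an open set `U ⊆ ℝ⁴`, and
`f1 x ≥ f2 x ≥ 0` are the unique reals with
`charpoly (G x * F x) = (X² + f1(x)²)(X² + f2(x)²)`, and if `f1 ≥ ε0 > 0`, `f2 ≥ ε0`
on `U`, then `f1 + f2` and `(f1 - f2)²` are `C^∞` on `U`. -/
theorem stmt_2 (U : Set (EuclideanSpace ℝ (Fin 4))) (hU : IsOpen U)
    (G F : EuclideanSpace ℝ (Fin 4) → Matrix (Fin 4) (Fin 4) ℝ)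
    (hGsm : ∀ i j, ContDiffOn ℝ (⊤ : ℕ∞) (fun x => G x i j) U)
    (hFsm : ∀ i j, ContDiffOn ℝ (⊤ : ℕ∞) (fun x => F x i j) U)
    (hGsymm : ∀ x ∈ U, (G x).IsSymm) (hGpd : ∀ x ∈ U, (G x).PosDef)
    (hFskew : ∀ x ∈ U, (F x).transpose = -(F x))
    (f1 f2 : EuclideanSpace ℝ (Fin 4) → ℝ)
    (hf : ∀ x ∈ U, f1 x ≥ f2 x ∧ f2 x ≥ 0 ∧
      (G x * F x).charpoly = (X ^ 2 + C (f1 x ^ 2)) * (X ^ 2 + C (f2 x ^ 2)))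
    (ε0 : ℝ) (hε0 : 0 < ε0) (hlower : ∀ x ∈ U, ε0 ≤ f1 x ∧ ε0 ≤ f2 x) :
    ContDiffOn ℝ (⊤ : ℕ∞) (fun x => f1 x + f2 x) U ∧
    ContDiffOn ℝ (⊤ : ℕ∞) (fun x => (f1 x - f2 x) ^ 2) U := by
  have hM : ∀ i j, ContDiffOn ℝ (⊤ : ℕ∞) (fun x => (G x * F x) i j) U := fun i j => by
    simp only [Matrix.mul_apply]
    exact ContDiffOn.sum fun k _ => (hGsm i k).mul (hFsm k j)
  -- The values of the characteristic polynomial at `0` and `1` determine its coefficients.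
  have hchar : ∀ t : ℝ, ContDiffOn ℝ (⊤ : ℕ∞)
      (fun x => (t ^ 2 + f1 x ^ 2) * (t ^ 2 + f2 x ^ 2)) U := fun t => by
    have hdet : ContDiffOn ℝ (⊤ : ℕ∞) (fun x => (Matrix.scalar (Fin 4) t - G x * F x).det) U :=
      ContDiffOn.matrix_det fun i j => by
        simp only [Matrix.sub_apply]
        exact contDiffOn_const.sub (hM i j)
    refine hdet.congr fun x hx => ?_
    rw [← Matrix.eval_charpoly, (hf x hx).2.2]
    simp
  have hpos : ∀ x ∈ U, 0 < f1 x ∧ 0 < f2 x := fun x hx =>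
    ⟨hε0.trans_le (hlower x hx).1, hε0.trans_le (hlower x hx).2⟩
  have hprod : ContDiffOn ℝ (⊤ : ℕ∞) (fun x => f1 x * f2 x) U := by
    refine ((hchar 0).sqrt fun x hx => ?_).congr fun x hx => ?_
    · obtain ⟨h1, h2⟩ := hpos x hx
      positivity
    · obtain ⟨h1, h2⟩ := hpos x hx
      rw [show ((0 : ℝ) ^ 2 + f1 x ^ 2) * (0 ^ 2 + f2 x ^ 2) = (f1 x * f2 x) ^ 2 by ring,
        Real.sqrt_sq (by positivity)]
  have hsq : ContDiffOn ℝ (⊤ : ℕ∞) (fun x => f1 x ^ 2 + f2 x ^ 2) U :=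
    (((hchar 1).sub (hchar 0)).sub (contDiffOn_const (c := (1 : ℝ)))).congr
      fun x _ => by ring
  constructor
  · have hsum : ContDiffOn ℝ (⊤ : ℕ∞) (fun x => (f1 x + f2 x) ^ 2) U :=
      (hsq.add ((contDiffOn_const (c := (2 : ℝ))).mul hprod)).congr fun x _ => by ring
    refine (hsum.sqrt fun x hx => ?_).congr fun x hx => ?_
    · obtain ⟨h1, h2⟩ := hpos x hx
      positivity
    · obtain ⟨h1, h2⟩ := hpos x hx
      rw [Real.sqrt_sq (by positivity)]
  · exact (hsq.sub ((contDiffOn_const (c := (2 : ℝ))).mul hprod)).congr fun x _ => by ring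
end

section
/- Let U ⊆ ℝ⁴ be open, V_1,…,V_4 ∈ C^∞(U) real-valued, μ > 0, p_j(x,ξ) := ξ_j − μ V_j(x), F_{jk} := ∂_j V_k − ∂_k V_j, and suppose (F_{jk}(x)) is invertible for every x ∈ U with inverse (φ^{jl}(x)). Let (g^{km}) be a symmetric matrix of functions in C^∞(U), and define x'_j := x_j − μ^{-1} Σ_l φ^{jl} p_l. Define the Poisson bracket of functions on U × ℝ⁴ by {u,v} := Σ_{m=1}^{4} (∂_{ξ_m}u · ∂_{x_m}v − ∂_{x_m}u · ∂_{ξ_m}v). Then {(1/2) Σ_{k,m} g^{km} p_k p_m , x'_j} = μ^{-1} Σ_{k,m,l} ( (1/2) φ^{jl} {p_l, g^{km}} − {p_l, φ^{jk}} g^{ml} ) p_k p_m for every j. -/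
/-- The Poisson bracket `{u,v} = Σ_m (∂_{ξ_m}u ∂_{x_m}v − ∂_{x_m}u ∂_{ξ_m}v)` of two
functions on phase space `ℝ⁴ × ℝ⁴` (first factor `x`, second factor `ξ`). -/
noncomputable def poissonBracket (u v : ((Fin 4 → ℝ) × (Fin 4 → ℝ)) → ℝ)
    (z : (Fin 4 → ℝ) × (Fin 4 → ℝ)) : ℝ :=
  ∑ m : Fin 4,
    (fderiv ℝ u z (0, Pi.single m 1) * fderiv ℝ v z (Pi.single m 1, 0) -
     fderiv ℝ u z (Pi.single m 1, 0) * fderiv ℝ v z (0, Pi.single m 1))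

namespace poissonBracket

variable {u v w : (Fin 4 → ℝ) × (Fin 4 → ℝ) → ℝ} {z : (Fin 4 → ℝ) × (Fin 4 → ℝ)}

theorem antisymm (u v : (Fin 4 → ℝ) × (Fin 4 → ℝ) → ℝ) (z : (Fin 4 → ℝ) × (Fin 4 → ℝ)) :
    poissonBracket u v z = -poissonBracket v u z := by
  simp only [poissonBracket, ← Finset.sum_neg_distrib]
  exact Finset.sum_congr rfl fun m _ => by ring

theorem sub_right (hv : DifferentiableAt ℝ v z) (hw : DifferentiableAt ℝ w z) :
    poissonBracket u (fun y => v y - w y) z = poissonBracket u v z - poissonBracket u w z := by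
  simp only [poissonBracket, fderiv_fun_sub hv hw, ← Finset.sum_sub_distrib,
    sub_apply]
  exact Finset.sum_congr rfl fun m _ => by ring

theorem mul_right (hv : DifferentiableAt ℝ v z) (hw : DifferentiableAt ℝ w z) :
    poissonBracket u (fun y => v y * w y) z =
      poissonBracket u v z * w z + v z * poissonBracket u w z := by
  simp only [poissonBracket, fderiv_fun_mul hv hw, Finset.sum_mul, Finset.mul_sum,
    ← Finset.sum_add_distrib, add_apply, smul_apply,
    smul_eq_mul]
  exact Finset.sum_congr rfl fun m _ => by ring

theorem const_mul_right (c : ℝ) (hv : DifferentiableAt ℝ v z) :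
    poissonBracket u (fun y => c * v y) z = c * poissonBracket u v z := by
  simp only [poissonBracket, fderiv_const_mul hv, Finset.mul_sum,
    smul_apply, smul_eq_mul]
  exact Finset.sum_congr rfl fun m _ => by ring

theorem sum_right {ι : Type*} (s : Finset ι) {f : ι → (Fin 4 → ℝ) × (Fin 4 → ℝ) → ℝ}
    (hf : ∀ i ∈ s, DifferentiableAt ℝ (f i) z) :
    poissonBracket u (fun y => ∑ i ∈ s, f i y) z = ∑ i ∈ s, poissonBracket u (f i) z := by
  simp only [poissonBracket, fderiv_fun_sum hf, sum_apply, Finset.mul_sum,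
    ← Finset.sum_sub_distrib]
  exact Finset.sum_comm

theorem mul_left (hv : DifferentiableAt ℝ v z) (hw : DifferentiableAt ℝ w z) :
    poissonBracket (fun y => v y * w y) u z =
      poissonBracket v u z * w z + v z * poissonBracket w u z := by
  rw [antisymm, mul_right hv hw, antisymm v, antisymm w]
  ring

theorem const_mul_left (c : ℝ) (hv : DifferentiableAt ℝ v z) :
    poissonBracket (fun y => c * v y) u z = c * poissonBracket v u z := by
  rw [antisymm, const_mul_right c hv, antisymm v, mul_neg]

theorem sum_left {ι : Type*} (s : Finset ι) {f : ι → (Fin 4 → ℝ) × (Fin 4 → ℝ) → ℝ}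
    (hf : ∀ i ∈ s, DifferentiableAt ℝ (f i) z) :
    poissonBracket (fun y => ∑ i ∈ s, f i y) u z = ∑ i ∈ s, poissonBracket (f i) u z := by
  rw [antisymm, sum_right s hf, ← Finset.sum_neg_distrib]
  exact Finset.sum_congr rfl fun i _ => (antisymm _ _ _).symm

/-- Derivative of a function of the position variable only. -/
theorem fderiv_comp_fst_apply {f : (Fin 4 → ℝ) → ℝ} (hf : DifferentiableAt ℝ f z.1)
    (a : (Fin 4 → ℝ) × (Fin 4 → ℝ)) :
    fderiv ℝ (fun y : (Fin 4 → ℝ) × (Fin 4 → ℝ) => f y.1) z a = fderiv ℝ f z.1 a.1 := by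
  have h : HasFDerivAt (fun y : (Fin 4 → ℝ) × (Fin 4 → ℝ) => f y.1) _ z :=
    hf.hasFDerivAt.comp z hasFDerivAt_fst
  rw [h.fderiv]
  rfl

theorem comp_fst_comp_fst {f h : (Fin 4 → ℝ) → ℝ} (hf : DifferentiableAt ℝ f z.1)
    (hh : DifferentiableAt ℝ h z.1) :
    poissonBracket (fun y => f y.1) (fun y => h y.1) z = 0 := by
  simp [poissonBracket, fderiv_comp_fst_apply hf, fderiv_comp_fst_apply hh]

/-- Derivative of the magnetic momentum `ξ_k - c V(x)`. -/
theorem fderiv_momentum_apply {V : (Fin 4 → ℝ) → ℝ} (hV : DifferentiableAt ℝ V z.1) (c : ℝ)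
    (k : Fin 4) (a : (Fin 4 → ℝ) × (Fin 4 → ℝ)) :
    fderiv ℝ (fun y : (Fin 4 → ℝ) × (Fin 4 → ℝ) => y.2 k - c * V y.1) z a =
      a.2 k - c * fderiv ℝ V z.1 a.1 := by
  have hfst : DifferentiableAt ℝ (fun y : (Fin 4 → ℝ) × (Fin 4 → ℝ) => V y.1) z :=
    hV.comp z differentiableAt_fst
  have hsnd : HasFDerivAt (fun y : (Fin 4 → ℝ) × (Fin 4 → ℝ) => y.2 k)
      ((ContinuousLinearMap.proj k : (Fin 4 → ℝ) →L[ℝ] ℝ) ∘L ContinuousLinearMap.snd ℝ _ _) z :=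
    ((ContinuousLinearMap.proj k : (Fin 4 → ℝ) →L[ℝ] ℝ) ∘L
      ContinuousLinearMap.snd ℝ (Fin 4 → ℝ) (Fin 4 → ℝ)).hasFDerivAt
  rw [(hsnd.fun_sub (hfst.hasFDerivAt.const_mul c)).fderiv, sub_apply, smul_apply,
    fderiv_comp_fst_apply hV]
  rfl

theorem momentum_coord {V : (Fin 4 → ℝ) → ℝ} (hV : DifferentiableAt ℝ V z.1) (c : ℝ)
    (k j : Fin 4) :
    poissonBracket (fun y => y.2 k - c * V y.1) (fun y => y.1 j) z = if j = k then 1 else 0 := by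
  have h (a : (Fin 4 → ℝ) × (Fin 4 → ℝ)) :
      fderiv ℝ (fun y : (Fin 4 → ℝ) × (Fin 4 → ℝ) => y.1 j) z a = a.1 j := by
    rw [fderiv_comp_fst_apply (f := fun x => x j) (by fun_prop), (hasFDerivAt_apply j z.1).fderiv]
    rfl
  simp [poissonBracket, fderiv_momentum_apply hV, h, Pi.single_apply, eq_comm]

theorem momentum_momentum {V W : (Fin 4 → ℝ) → ℝ} (hV : DifferentiableAt ℝ V z.1)
    (hW : DifferentiableAt ℝ W z.1) (c : ℝ) (k l : Fin 4) :
    poissonBracket (fun y => y.2 k - c * V y.1) (fun y => y.2 l - c * W y.1) z =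
      -c * (fderiv ℝ W z.1 (Pi.single k 1) - fderiv ℝ V z.1 (Pi.single l 1)) := by
  simp [poissonBracket, fderiv_momentum_apply hV, fderiv_momentum_apply hW, Pi.single_apply]
  ring

end poissonBracket

/-- Regrouping of the two Leibniz terms of a quadratic form with symmetric coefficients. -/
theorem half_sum_leibniz_quadratic {ι : Type*} [Fintype ι] (c : ℝ) (a q : ι → ℝ)
    (g B : ι → ι → ℝ) (G : ι → ι → ι → ℝ) (hg : ∀ k m, g k m = g m k) :
    1 / 2 * ∑ k, ∑ m, (((c * ∑ l, a l * G l k m) * q k + g k m * (-c * ∑ l, B k l * q l)) * q m +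
        g k m * q k * (-c * ∑ l, B m l * q l)) =
      c * ∑ k, ∑ m, ∑ l, (1 / 2 * a l * G l k m - B l k * g m l) * q k * q m := by
  have hfst : ∑ k, ∑ m, ∑ l, g k m * B k l * q l * q m =
      ∑ k, ∑ m, ∑ l, B l k * g m l * q k * q m := by
    calc _ = ∑ m, ∑ k, ∑ l, g k m * B k l * q l * q m := Finset.sum_comm
      _ = ∑ m, ∑ l, ∑ k, g k m * B k l * q l * q m :=
        Finset.sum_congr rfl fun m _ => Finset.sum_comm
      _ = ∑ l, ∑ m, ∑ k, g k m * B k l * q l * q m := Finset.sum_comm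
      _ = _ := Finset.sum_congr rfl fun k _ => Finset.sum_congr rfl fun m _ =>
        Finset.sum_congr rfl fun l _ => by rw [hg l m]; ring
  have hsnd : ∑ k, ∑ m, ∑ l, g k m * q k * B m l * q l =
      ∑ k, ∑ m, ∑ l, B l k * g m l * q k * q m := by
    rw [← hfst, Finset.sum_comm]
    exact Finset.sum_congr rfl fun k _ => Finset.sum_congr rfl fun m _ =>
      Finset.sum_congr rfl fun l _ => by rw [hg m k]; ring
  calc _ = 1 / 2 * c * ∑ k, ∑ m, ∑ l, a l * G l k m * q k * q m -
        1 / 2 * c * ∑ k, ∑ m, ∑ l, g k m * B k l * q l * q m -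
        1 / 2 * c * ∑ k, ∑ m, ∑ l, g k m * q k * B m l * q l := by
        simp only [Finset.mul_sum, Finset.sum_mul, ← Finset.sum_add_distrib,
          ← Finset.sum_sub_distrib]
        exact Finset.sum_congr rfl fun k _ => Finset.sum_congr rfl fun m _ =>
          Finset.sum_congr rfl fun l _ => by ring
    _ = 1 / 2 * c * ∑ k, ∑ m, ∑ l, a l * G l k m * q k * q m -
        c * ∑ k, ∑ m, ∑ l, B l k * g m l * q k * q m := by rw [hfst, hsnd]; ring
    _ = _ := by
        simp only [Finset.mul_sum, ← Finset.sum_sub_distrib]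
        exact Finset.sum_congr rfl fun k _ => Finset.sum_congr rfl fun m _ =>
          Finset.sum_congr rfl fun l _ => by ring

/-- With `p_j(x,ξ) = ξ_j − μ V_j(x)`, `F_{jk} = ∂_j V_k − ∂_k V_j`
invertible on `U` with smooth inverse `(φ^{jl})`, a symmetric matrix `(g^{km})` of smooth
functions, and `x'_j = x_j − μ⁻¹ Σ_l φ^{jl} p_l`, one has the identity (1.10):
`{½ Σ_{k,m} g^{km} p_k p_m, x'_j}
   = μ⁻¹ Σ_{k,m,l} ( ½ φ^{jl}{p_l, g^{km}} − {p_l, φ^{jk}} g^{ml} ) p_k p_m`. -/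
theorem stmt_4 (U : Set (Fin 4 → ℝ)) (hU : IsOpen U)
    (V : Fin 4 → (Fin 4 → ℝ) → ℝ) (hV : ∀ j, ContDiffOn ℝ (⊤ : ℕ∞) (V j) U)
    (μ : ℝ) (hμ : 0 < μ)
    (p : Fin 4 → ((Fin 4 → ℝ) × (Fin 4 → ℝ)) → ℝ)
    (hp : ∀ j z, p j z = z.2 j - μ * V j z.1)
    (F : Fin 4 → Fin 4 → (Fin 4 → ℝ) → ℝ)
    (hF : ∀ j k x, F j k x =
      fderiv ℝ (V k) x (Pi.single j 1) - fderiv ℝ (V j) x (Pi.single k 1))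
    (φ : Fin 4 → Fin 4 → (Fin 4 → ℝ) → ℝ)
    (hφsm : ∀ j l, ContDiffOn ℝ (⊤ : ℕ∞) (φ j l) U)
    (hφF : ∀ x ∈ U, ∀ j k, ∑ l, F j l x * φ l k x = if j = k then 1 else 0)
    (hFφ : ∀ x ∈ U, ∀ j k, ∑ l, φ j l x * F l k x = if j = k then 1 else 0)
    (g : Fin 4 → Fin 4 → (Fin 4 → ℝ) → ℝ)
    (hg : ∀ k m, ContDiffOn ℝ (⊤ : ℕ∞) (g k m) U)
    (hgsymm : ∀ k m x, g k m x = g m k x)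
    (x' : Fin 4 → ((Fin 4 → ℝ) × (Fin 4 → ℝ)) → ℝ)
    (hx' : ∀ j z, x' j z = z.1 j - μ⁻¹ * ∑ l, φ j l z.1 * p l z) :
    ∀ j, ∀ z : (Fin 4 → ℝ) × (Fin 4 → ℝ), z.1 ∈ U →
      poissonBracket (fun w => (1 / 2) * ∑ k, ∑ m, g k m w.1 * p k w * p m w) (x' j) z =
        μ⁻¹ * ∑ k, ∑ m, ∑ l,
          ((1 / 2) * φ j l z.1 * poissonBracket (p l) (fun w => g k m w.1) z -
            poissonBracket (p l) (fun w => φ j k w.1) z * g m l z.1) * p k z * p m z := by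
  intro j z hz
  have hdiff {f : (Fin 4 → ℝ) → ℝ} (hf : ContDiffOn ℝ (⊤ : ℕ∞) f U) : DifferentiableAt ℝ f z.1 :=
    (hf.contDiffAt (hU.mem_nhds hz)).differentiableAt (by simp)
  have hfst {f : (Fin 4 → ℝ) → ℝ} (hf : ContDiffOn ℝ (⊤ : ℕ∞) f U) :
      DifferentiableAt ℝ (fun y : (Fin 4 → ℝ) × (Fin 4 → ℝ) => f y.1) z :=
    (hdiff hf).comp z differentiableAt_fst
  have hp_eq (k : Fin 4) : p k = fun y => y.2 k - μ * V k y.1 := funext (hp k)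
  have hx_eq : x' j = fun y => y.1 j - μ⁻¹ * ∑ l, φ j l y.1 * p l y := funext (hx' j)
  have hpd (k : Fin 4) : DifferentiableAt ℝ (p k) z := by
    rw [hp_eq]
    exact DifferentiableAt.sub (by fun_prop) ((hfst (hV k)).const_mul μ)
  have hφp (l : Fin 4) : DifferentiableAt ℝ (fun y => φ j l y.1 * p l y) z :=
    (hfst (hφsm j l)).mul (hpd l)
  have bracket_x' (u : (Fin 4 → ℝ) × (Fin 4 → ℝ) → ℝ) :
      poissonBracket u (x' j) z = poissonBracket u (fun y => y.1 j) z - μ⁻¹ *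
        ∑ l, (poissonBracket u (fun y => φ j l y.1) z * p l z +
          φ j l z.1 * poissonBracket u (p l) z) := by
    have hsum : DifferentiableAt ℝ (fun y => ∑ l, φ j l y.1 * p l y) z :=
      DifferentiableAt.fun_sum fun l _ => hφp l
    rw [hx_eq, poissonBracket.sub_right (by fun_prop) (hsum.const_mul _),
      poissonBracket.const_mul_right _ hsum, poissonBracket.sum_right _ fun l _ => hφp l]
    simp only [poissonBracket.mul_right (hfst (hφsm j _)) (hpd _)]
  have bracket_p_x' (k : Fin 4) : poissonBracket (p k) (x' j) z =
      -μ⁻¹ * ∑ l, poissonBracket (p k) (fun y => φ j l y.1) z * p l z := by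
    have hpp (l : Fin 4) : poissonBracket (p k) (p l) z = μ * F l k z.1 := by
      rw [hp_eq, hp_eq, poissonBracket.momentum_momentum (hdiff (hV k)) (hdiff (hV l)), hF]
      ring
    have hcoord : poissonBracket (p k) (fun y => y.1 j) z = if j = k then 1 else 0 := by
      rw [hp_eq, poissonBracket.momentum_coord (hdiff (hV k))]
    have hcancel : ∑ l, φ j l z.1 * (μ * F l k z.1) = μ * if j = k then 1 else 0 := by
      rw [← hFφ z.1 hz j k, Finset.mul_sum]
      exact Finset.sum_congr rfl fun l _ => by ring
    simp only [bracket_x', hpp, hcoord, Finset.sum_add_distrib, hcancel]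
    rw [mul_add, inv_mul_cancel_left₀ hμ.ne']
    ring
  have bracket_g_x' (k m : Fin 4) : poissonBracket (fun y => g k m y.1) (x' j) z =
      μ⁻¹ * ∑ l, φ j l z.1 * poissonBracket (p l) (fun y => g k m y.1) z := by
    have hφ (l : Fin 4) := poissonBracket.comp_fst_comp_fst (hdiff (hg k m)) (hdiff (hφsm j l))
    have hcoord := poissonBracket.comp_fst_comp_fst (h := fun x => x j) (hdiff (hg k m))
      (by fun_prop)
    simp only [bracket_x', hφ, hcoord, poissonBracket.antisymm (fun y => g k m y.1) (p _)]
    simp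
  have hgp (k m : Fin 4) : DifferentiableAt ℝ (fun y => g k m y.1 * p k y) z :=
    (hfst (hg k m)).mul (hpd k)
  have hgpp (k m : Fin 4) : DifferentiableAt ℝ (fun y => g k m y.1 * p k y * p m y) z :=
    (hgp k m).mul (hpd m)
  have hgpp_sum (k : Fin 4) :
      DifferentiableAt ℝ (fun y => ∑ m, g k m y.1 * p k y * p m y) z :=
    DifferentiableAt.fun_sum fun m _ => hgpp k m
  rw [poissonBracket.const_mul_left _ (DifferentiableAt.fun_sum fun k _ => hgpp_sum k),
    poissonBracket.sum_left _ fun k _ => hgpp_sum k]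
  simp only [poissonBracket.sum_left _ fun m _ => hgpp _ m,
    poissonBracket.mul_left (hgp _ _) (hpd _), poissonBracket.mul_left (hfst (hg _ _)) (hpd _),
    bracket_g_x', bracket_p_x']
  exact half_sum_leibniz_quadratic μ⁻¹ (fun l => φ j l z.1) (fun k => p k z)
    (fun k m => g k m z.1) (fun k l => poissonBracket (p k) (fun y => φ j l y.1) z)
    (fun l k m => poissonBracket (p l) (fun y => g k m y.1) z) fun k m => hgsymm k m z.1
end

section
/- Let U ⊆ ℝ⁴ be open, let f1, f2, V ∈ C^∞(U) be strictly positive, and define φ_α := α log f1 + (1−α) log f2 − log V for α ∈ ℝ. Let x̄ ∈ U and ε0 > 0 satisfy ‖∇(f1 f2^{-1})(x̄)‖ ≥ ε0. Then there exist an open neighborhood U' ⊆ U of x̄, a constant ε > 0, and a C^∞ function ᾱ : U' → ℝ such that ‖∇φ_α(x)‖ ≥ ε |α − ᾱ(x)| for every x ∈ U' and every α ∈ [0,1]. -/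
/-- Near a point where `g` is not critical, the derivative of the affine pencil `α g + h` is bounded
below by a multiple of the distance from `α` to a smooth function. -/
theorem exists_contDiffOn_le_norm_fderiv_mul_add {E : Type*} [NormedAddCommGroup E]
    [NormedSpace ℝ E] {U : Set E} (hU : IsOpen U) {g h : E → ℝ}
    (hg : ContDiffOn ℝ (⊤ : ℕ∞) g U) (hh : ContDiffOn ℝ (⊤ : ℕ∞) h U)
    {x₀ : E} (hx₀ : x₀ ∈ U) (hg₀ : fderiv ℝ g x₀ ≠ 0) :
    ∃ U' ⊆ U, IsOpen U' ∧ x₀ ∈ U' ∧ ∃ ε > (0 : ℝ),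
      ∃ a : E → ℝ, ContDiffOn ℝ (⊤ : ℕ∞) a U' ∧
        ∀ x ∈ U', ∀ α : ℝ, ε * |α - a x| ≤ ‖fderiv ℝ (fun y => α * g y + h y) x‖ := by
  obtain ⟨v, hv⟩ : ∃ v, fderiv ℝ g x₀ v ≠ 0 := by
    by_contra! hzero
    exact hg₀ (ContinuousLinearMap.ext hzero)
  have hv_pos : 0 < ‖v‖ := norm_pos_iff.2 fun hv0 => hv (by simp [hv0])
  have hdg : ContDiffOn ℝ (⊤ : ℕ∞) (fun x => fderiv ℝ g x v) U :=
    (hg.fderiv_of_isOpen hU (by simp)).clm_apply contDiffOn_const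
  have hdh : ContDiffOn ℝ (⊤ : ℕ∞) (fun x => fderiv ℝ h x v) U :=
    (hh.fderiv_of_isOpen hU (by simp)).clm_apply contDiffOn_const
  set c : ℝ := |fderiv ℝ g x₀ v| / 2
  have hc_pos : 0 < c := half_pos (abs_pos.2 hv)
  refine ⟨U ∩ (fun x => |fderiv ℝ g x v|) ⁻¹' Set.Ioi c, Set.inter_subset_left,
    hdg.continuousOn.abs.isOpen_inter_preimage hU isOpen_Ioi,
    ⟨hx₀, half_lt_self (abs_pos.2 hv)⟩, c / ‖v‖, div_pos hc_pos hv_pos,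
    fun x => -fderiv ℝ h x v / fderiv ℝ g x v, ?_, ?_⟩
  · refine (hdh.mono Set.inter_subset_left).neg.div (hdg.mono Set.inter_subset_left) ?_
    rintro x ⟨-, hx⟩
    exact abs_pos.1 (hc_pos.trans hx)
  · rintro x ⟨hxU, hx⟩ α
    have hx : c < |fderiv ℝ g x v| := hx
    have hne : fderiv ℝ g x v ≠ 0 := abs_pos.1 (hc_pos.trans hx)
    have hgx : DifferentiableAt ℝ g x :=
      (hg.contDiffAt (hU.mem_nhds hxU)).differentiableAt (by simp)
    have hhx : DifferentiableAt ℝ h x :=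
      (hh.contDiffAt (hU.mem_nhds hxU)).differentiableAt (by simp)
    have hD : fderiv ℝ (fun y => α * g y + h y) x v
        = fderiv ℝ g x v * (α - -fderiv ℝ h x v / fderiv ℝ g x v) := by
      rw [((hgx.hasFDerivAt.const_mul α).fun_add hhx.hasFDerivAt).fderiv]
      simp only [add_apply, smul_apply, smul_eq_mul]
      field_simp
      ring
    have hle := (fderiv ℝ (fun y => α * g y + h y) x).le_opNorm v
    rw [hD, Real.norm_eq_abs, abs_mul] at hle
    rw [div_mul_eq_mul_div, div_le_iff₀ hv_pos]
    exact (mul_le_mul_of_nonneg_right hx.le (abs_nonneg _)).trans hle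

theorem norm_gradient {E : Type*} [NormedAddCommGroup E] [InnerProductSpace ℝ E] [CompleteSpace E]
    (f : E → ℝ) (x : E) : ‖gradient f x‖ = ‖fderiv ℝ f x‖ :=
  LinearIsometryEquiv.norm_map _ _

/-- If `f1, f2, V` are smooth positive functions on an open `U ⊆ ℝ⁴` and
`‖∇(f1/f2)(x̄)‖ ≥ ε0 > 0`, then near `x̄` there are `ε > 0` and a smooth function `ᾱ` with
`‖∇φ_α(x)‖ ≥ ε|α − ᾱ(x)|` for all `α ∈ [0,1]`, where
`φ_α = α log f1 + (1−α) log f2 − log V`. -/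
theorem stmt_6 (U : Set (EuclideanSpace ℝ (Fin 4))) (hU : IsOpen U)
    (f1 f2 V : EuclideanSpace ℝ (Fin 4) → ℝ)
    (hf1 : ContDiffOn ℝ (⊤ : ℕ∞) f1 U) (hf2 : ContDiffOn ℝ (⊤ : ℕ∞) f2 U) (hV : ContDiffOn ℝ (⊤ : ℕ∞) V U)
    (hf1pos : ∀ x ∈ U, 0 < f1 x) (hf2pos : ∀ x ∈ U, 0 < f2 x) (hVpos : ∀ x ∈ U, 0 < V x)
    (x₀ : EuclideanSpace ℝ (Fin 4)) (hx₀ : x₀ ∈ U)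
    (ε0 : ℝ) (hε0 : 0 < ε0)
    (hgrad : ε0 ≤ ‖gradient (fun x => f1 x / f2 x) x₀‖) :
    ∃ U' ⊆ U, IsOpen U' ∧ x₀ ∈ U' ∧ ∃ ε > (0 : ℝ),
      ∃ αbar : EuclideanSpace ℝ (Fin 4) → ℝ, ContDiffOn ℝ (⊤ : ℕ∞) αbar U' ∧
        ∀ x ∈ U', ∀ α ∈ Set.Icc (0 : ℝ) 1,
          ε * |α - αbar x| ≤
            ‖gradient
              (fun y => α * Real.log (f1 y) + (1 - α) * Real.log (f2 y) - Real.log (V y))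
              x‖ := by
  have hl1 := hf1.log fun x hx => (hf1pos x hx).ne'
  have hl2 := hf2.log fun x hx => (hf2pos x hx).ne'
  have hlV := hV.log fun x hx => (hVpos x hx).ne'
  have hg := hl1.sub hl2
  have hg₀ : fderiv ℝ (fun x => Real.log (f1 x) - Real.log (f2 x)) x₀ ≠ 0 := by
    intro hzero
    have hdiff : DifferentiableAt ℝ (fun x => Real.log (f1 x) - Real.log (f2 x)) x₀ :=
      (hg.contDiffAt (hU.mem_nhds hx₀)).differentiableAt (by simp)
    have hexp : (fun x => f1 x / f2 x) =ᶠ[nhds x₀]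
        fun x => Real.exp (Real.log (f1 x) - Real.log (f2 x)) := by
      filter_upwards [hU.mem_nhds hx₀] with x hx
      rw [Real.exp_sub, Real.exp_log (hf1pos x hx), Real.exp_log (hf2pos x hx)]
    rw [norm_gradient, hexp.fderiv_eq, hdiff.hasFDerivAt.exp.fderiv, hzero, smul_zero,
      norm_zero] at hgrad
    exact hε0.not_ge hgrad
  obtain ⟨U', hU'U, hU', hx₀', ε, hε, a, ha, hbound⟩ :=
    exists_contDiffOn_le_norm_fderiv_mul_add hU hg (hl2.sub hlV) hx₀ hg₀
  refine ⟨U', hU'U, hU', hx₀', ε, hε, a, ha, fun x hx α _ => ?_⟩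
  rw [norm_gradient]
  convert hbound x hx α using 4
  ring
end

section
/- Let n ∈ ℕ, M ≥ 0, and let V : ℝⁿ → ℝ be twice continuously differentiable with ‖Hess V(x)‖ ≤ M (operator norm) for all x ∈ ℝⁿ. Then the function ℓ(x) := (|V(x)| + ‖∇V(x)‖²)^{1/2} is Lipschitz continuous with Lipschitz constant (1 + 2M)/2, i.e. |ℓ(x) − ℓ(y)| ≤ ((1 + 2M)/2)·‖x − y‖ for all x, y ∈ ℝⁿ. -/
section LipschitzScale

variable {E : Type*} [NormedAddCommGroup E] [InnerProductSpace ℝ E] [CompleteSpace E]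
  {V : E → ℝ} {M : ℝ}

theorem exists_hasFDerivAt_gradient_norm_le (hV : ContDiff ℝ 2 V) {x : E}
    (hx : ‖iteratedFDeriv ℝ 2 V x‖ ≤ M) :
    ∃ G : E →L[ℝ] E, HasFDerivAt (gradient V) G x ∧ ‖G‖ ≤ M := by
  have hd : DifferentiableAt ℝ (fderiv ℝ V) x :=
    ((hV.fderiv_right (m := 1) (by norm_num)).differentiable (by norm_num)) x
  let L : StrongDual ℝ E ≃ₗᵢ[ℝ] E := (InnerProductSpace.toDual ℝ E).symm
  refine ⟨(L.toContinuousLinearEquiv : StrongDual ℝ E →L[ℝ] E).comp (fderiv ℝ (fderiv ℝ V) x),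
    L.toContinuousLinearEquiv.hasFDerivAt.comp x hd.hasFDerivAt, ?_⟩
  have hn : ‖fderiv ℝ (fderiv ℝ V) x‖ ≤ M := by
    rwa [← norm_iteratedFDeriv_one, norm_iteratedFDeriv_fderiv]
  refine ContinuousLinearMap.opNorm_le_bound _ ((norm_nonneg _).trans hx) fun v => ?_
  calc ‖L (fderiv ℝ (fderiv ℝ V) x v)‖ = ‖fderiv ℝ (fderiv ℝ V) x v‖ := L.norm_map _
    _ ≤ M * ‖v‖ := ContinuousLinearMap.le_of_opNorm_le _ hn v

/-- The regularization of `√(|V| + ‖∇V‖²)` in which `|V|` is replaced by `√(V² + δ²)`. -/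
noncomputable def regularizedScale (V : E → ℝ) (δ : ℝ) (x : E) : ℝ :=
  √(√(V x ^ 2 + δ ^ 2) + ‖gradient V x‖ ^ 2)

theorem exists_hasFDerivAt_regularizedScale_norm_le (hV : ContDiff ℝ 2 V) {x : E}
    (hx : ‖iteratedFDeriv ℝ 2 V x‖ ≤ M) {δ : ℝ} (hδ : δ ≠ 0) :
    ∃ D : E →L[ℝ] ℝ, HasFDerivAt (regularizedScale V δ) D x ∧ ‖D‖ ≤ (1 + 2 * M) / 2 := by
  obtain ⟨G, hG, hGM⟩ := exists_hasFDerivAt_gradient_norm_le hV hx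
  have hM : 0 ≤ M := (norm_nonneg _).trans hGM
  have hVx : HasFDerivAt V (fderiv ℝ V x) x :=
    ((hV.differentiable (by norm_num)) x).hasFDerivAt
  have hpos : 0 < V x ^ 2 + δ ^ 2 := by positivity
  have hinner : HasFDerivAt (fun y => √(V y ^ 2 + δ ^ 2)) _ x :=
    ((hVx.pow 2).add_const (δ ^ 2)).sqrt hpos.ne'
  have hpos' : 0 < √(V x ^ 2 + δ ^ 2) + ‖gradient V x‖ ^ 2 := by positivity
  refine ⟨_, (hinner.add hG.norm_sq).sqrt hpos'.ne', ?_⟩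
  refine ContinuousLinearMap.opNorm_le_bound _ (by positivity) fun v => ?_
  have hs : 0 < √(V x ^ 2 + δ ^ 2) := Real.sqrt_pos.2 hpos
  have hl : 0 < √(√(V x ^ 2 + δ ^ 2) + ‖gradient V x‖ ^ 2) := Real.sqrt_pos.2 hpos'
  have hgl : ‖gradient V x‖ ≤ √(√(V x ^ 2 + δ ^ 2) + ‖gradient V x‖ ^ 2) :=
    Real.le_sqrt_of_sq_le (by linarith)
  have hVs : |V x| ≤ √(V x ^ 2 + δ ^ 2) := Real.abs_le_sqrt (by nlinarith [sq_nonneg δ])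
  have hgrad : ‖fderiv ℝ V x‖ = ‖gradient V x‖ :=
    ((InnerProductSpace.toDual ℝ E).symm.norm_map _).symm
  have hfst : |V x / √(V x ^ 2 + δ ^ 2) * fderiv ℝ V x v| ≤ ‖gradient V x‖ * ‖v‖ := by
    rw [abs_mul, abs_div, abs_of_pos hs]
    calc |V x| / √(V x ^ 2 + δ ^ 2) * |fderiv ℝ V x v| ≤ 1 * (‖gradient V x‖ * ‖v‖) := by
          gcongr
          · exact (div_le_one hs).2 hVs
          · exact hgrad ▸ (fderiv ℝ V x).le_opNorm v
      _ = _ := one_mul _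
  have hsnd : |inner ℝ (gradient V x) (G v)| ≤ ‖gradient V x‖ * (M * ‖v‖) :=
    (abs_real_inner_le_norm _ _).trans
      (mul_le_mul_of_nonneg_left (G.le_of_opNorm_le hGM v) (norm_nonneg _))
  generalize √(√(V x ^ 2 + δ ^ 2) + ‖gradient V x‖ ^ 2) = l at *
  generalize √(V x ^ 2 + δ ^ 2) = s at *
  calc _ = |(V x / s * fderiv ℝ V x v + 2 * inner ℝ (gradient V x) (G v)) / (2 * l)| := by
        rw [Real.norm_eq_abs]
        congr 1
        simp
        field_simp
    _ ≤ (1 + 2 * M) / 2 * ‖v‖ := by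
        rw [abs_div, abs_of_pos (by positivity : 0 < 2 * l), div_le_iff₀ (by positivity)]
        calc _ ≤ ‖gradient V x‖ * ‖v‖ + 2 * (‖gradient V x‖ * (M * ‖v‖)) := by
              refine (abs_add_le _ _).trans (add_le_add hfst ?_)
              rw [abs_mul, abs_two]
              gcongr
          _ = ‖gradient V x‖ * ((1 + 2 * M) * ‖v‖) := by ring
          _ ≤ l * ((1 + 2 * M) * ‖v‖) := by gcongr
          _ = _ := by ring

theorem abs_regularizedScale_sub_le (hV : ContDiff ℝ 2 V)
    (hHess : ∀ x, ‖iteratedFDeriv ℝ 2 V x‖ ≤ M) {δ : ℝ} (hδ : δ ≠ 0) (x y : E) :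
    |regularizedScale V δ x - regularizedScale V δ y| ≤ (1 + 2 * M) / 2 * ‖x - y‖ := by
  choose D hD hDM using fun z =>
    exists_hasFDerivAt_regularizedScale_norm_le hV (hHess z) hδ
  exact convex_univ.norm_image_sub_le_of_norm_hasFDerivWithin_le
    (fun z _ => (hD z).hasFDerivWithinAt) (fun z _ => hDM z) (Set.mem_univ y) (Set.mem_univ x)

theorem continuous_regularizedScale_param (V : E → ℝ) (x : E) :
    Continuous fun δ => regularizedScale V δ x := by
  unfold regularizedScale
  fun_prop

theorem regularizedScale_zero (V : E → ℝ) (x : E) :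
    regularizedScale V 0 x = √(|V x| + ‖gradient V x‖ ^ 2) := by
  simp [regularizedScale, Real.sqrt_sq_eq_abs]

end LipschitzScale


/-- If `V : ℝⁿ → ℝ` is `C²` with Hessian bounded in operator norm by `M`,
then `ℓ(x) = (|V(x)| + ‖∇V(x)‖²)^(1/2)` is Lipschitz with constant `(1 + 2M)/2`:
`|ℓ(x) − ℓ(y)| ≤ ((1 + 2M)/2)‖x − y‖` for all `x, y`. -/
theorem stmt_10 (n : ℕ) (M : ℝ) (hM : 0 ≤ M)
    (V : EuclideanSpace ℝ (Fin n) → ℝ) (hV : ContDiff ℝ 2 V)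
    (hHess : ∀ x, ‖iteratedFDeriv ℝ 2 V x‖ ≤ M) :
    ∀ x y : EuclideanSpace ℝ (Fin n),
      |Real.sqrt (|V x| + ‖gradient V x‖ ^ 2) - Real.sqrt (|V y| + ‖gradient V y‖ ^ 2)| ≤
        ((1 + 2 * M) / 2) * ‖x - y‖ := by
  intro x y
  have hlim : Filter.Tendsto (fun δ => |regularizedScale V δ x - regularizedScale V δ y|)
      (nhdsWithin 0 {0}ᶜ) (nhds |regularizedScale V 0 x - regularizedScale V 0 y|) :=
    ((continuous_regularizedScale_param V x).sub
      (continuous_regularizedScale_param V y)).abs.continuousAt.tendsto.mono_left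
        nhdsWithin_le_nhds
  rw [← regularizedScale_zero, ← regularizedScale_zero]
  refine le_of_tendsto hlim ?_
  filter_upwards [self_mem_nhdsWithin] with δ hδ
  exact abs_regularizedScale_sub_le hV hHess hδ x y
end
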